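/- arXiv:2002.04790 — 2 statements merged into one kernel-verified Lean document; each statement's English description precedes it below -/
import Mathlib

section
/- Let M = (Q, W, R) be a hereditary abelian model structure on an abelian category A, and let A be cofibrant. Then for every short exact sequence 0 → F → B → B' → 0 with F fibrant, there is a long exact cohomology sequence ··· → ℓExtⁿ⁻¹_M(A,B') → ℓExtⁿ_M(A,F) → ℓExtⁿ_M(A,B) → ℓExtⁿ_M(A,B') → ℓExtⁿ⁺¹_M(A,F) → ···, where ℓExtⁿ_M(A,−) := Hⁿ[Hom_A(W_A, −)] for some M-resolution W_A of A. -/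
open CategoryTheory CategoryTheory.Limits

universe w v u

variable {C : Type u} [Category.{v} C] [Abelian C]

/-- A hereditary abelian model structure (Hovey triple) `(𝒬, 𝒲, ℛ)` on an abelian
category: `𝒲` is thick, `(𝒬, 𝒲 ∩ ℛ)` and `(𝒬 ∩ 𝒲, ℛ)` are complete cotorsion pairs, and
both cotorsion pairs are hereditary (`Extⁱ` vanishes for all `i ≥ 1`). -/
structure HoveyTriple (C : Type u) [Category.{v} C] [Abelian C] [HasExt.{w} C] where
  Q : C → Prop
  W : C → Prop
  R : C → Prop
  /-- `𝒲` is closed under retracts. -/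
  thick_retract : ∀ ⦃X Y : C⦄, (∃ (s : Y ⟶ X) (r : X ⟶ Y), s ≫ r = 𝟙 Y) → W X → W Y
  /-- `𝒲` satisfies the two-out-of-three property on short exact sequences. -/
  thick_two_of_three : ∀ ⦃X Y Z : C⦄ (i : X ⟶ Y) (p : Y ⟶ Z) (w : i ≫ p = 0),
    (ShortComplex.mk i p w).ShortExact →
      ((W X → W Y → W Z) ∧ (W X → W Z → W Y) ∧ (W Y → W Z → W X))
  /-- `Ext¹`-orthogonality of `𝒬` and `𝒲 ∩ ℛ`. -/
  orth₁ : ∀ ⦃X Y : C⦄, Q X → W Y → R Y → Subsingleton (Abelian.Ext X Y 1)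
  orth₁_left : ∀ ⦃X : C⦄, (∀ Y : C, W Y → R Y → Subsingleton (Abelian.Ext X Y 1)) → Q X
  orth₁_right : ∀ ⦃Y : C⦄, (∀ X : C, Q X → Subsingleton (Abelian.Ext X Y 1)) → W Y ∧ R Y
  /-- `Ext¹`-orthogonality of `𝒬 ∩ 𝒲` and `ℛ`. -/
  orth₂ : ∀ ⦃X Y : C⦄, Q X → W X → R Y → Subsingleton (Abelian.Ext X Y 1)
  orth₂_left : ∀ ⦃X : C⦄, (∀ Y : C, R Y → Subsingleton (Abelian.Ext X Y 1)) → Q X ∧ W X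
  orth₂_right : ∀ ⦃Y : C⦄, (∀ X : C, Q X → W X → Subsingleton (Abelian.Ext X Y 1)) → R Y
  /-- the cotorsion pair `(𝒬, 𝒲 ∩ ℛ)` has enough projectives. -/
  complete₁_proj : ∀ A : C, ∃ (K E : C) (i : K ⟶ E) (p : E ⟶ A) (w : i ≫ p = 0),
    Q E ∧ W K ∧ R K ∧ (ShortComplex.mk i p w).ShortExact
  /-- the cotorsion pair `(𝒬, 𝒲 ∩ ℛ)` has enough injectives. -/
  complete₁_inj : ∀ A : C, ∃ (E K : C) (i : A ⟶ E) (p : E ⟶ K) (w : i ≫ p = 0),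
    W E ∧ R E ∧ Q K ∧ (ShortComplex.mk i p w).ShortExact
  /-- the cotorsion pair `(𝒬 ∩ 𝒲, ℛ)` has enough projectives. -/
  complete₂_proj : ∀ A : C, ∃ (K E : C) (i : K ⟶ E) (p : E ⟶ A) (w : i ≫ p = 0),
    Q E ∧ W E ∧ R K ∧ (ShortComplex.mk i p w).ShortExact
  /-- the cotorsion pair `(𝒬 ∩ 𝒲, ℛ)` has enough injectives. -/
  complete₂_inj : ∀ A : C, ∃ (E K : C) (i : A ⟶ E) (p : E ⟶ K) (w : i ≫ p = 0),
    R E ∧ Q K ∧ W K ∧ (ShortComplex.mk i p w).ShortExact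
  /-- heredity of `(𝒬, 𝒲 ∩ ℛ)`. -/
  hereditary₁ : ∀ ⦃X Y : C⦄ (i : ℕ), 1 ≤ i → Q X → W Y → R Y →
    Subsingleton (Abelian.Ext X Y i)
  /-- heredity of `(𝒬 ∩ 𝒲, ℛ)`. -/
  hereditary₂ : ∀ ⦃X Y : C⦄ (i : ℕ), 1 ≤ i → Q X → W X → R Y →
    Subsingleton (Abelian.Ext X Y i)

variable [HasExt.{w} C]

/-- An `𝔐`-resolution of `A`: an everywhere-exact `ℤ`-indexed complex obtained by splicing
a resolution of `A` with components in `𝒬 ∩ 𝒲` and kernels in `ℛ` together with a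
coresolution of `A` with components in `𝒲 ∩ ℛ` and cokernels in `𝒬`. -/
structure MResolution (M : HoveyTriple.{w} C) (A : C) where
  c : ChainComplex C ℤ
  ε : c.X 0 ⟶ A
  η : A ⟶ c.X (-1)
  epi : Epi ε
  mono : Mono η
  fac : c.d 0 (-1) = ε ≫ η
  comp_pos : ∀ n : ℤ, 0 ≤ n → M.Q (c.X n) ∧ M.W (c.X n)
  comp_neg : ∀ n : ℤ, n < 0 → M.W (c.X n) ∧ M.R (c.X n)
  exact : ∀ n : ℤ, (ShortComplex.mk (c.d (n + 1) n) (c.d n (n - 1)) (c.d_comp_d _ _ _)).Exact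
  ker_eps : M.R (kernel ε)
  ker_d : ∀ n : ℤ, 1 ≤ n → M.R (kernel (c.d n (n - 1)))
  cok_eta : M.Q (cokernel η)
  cok_d : ∀ n : ℤ, n ≤ -1 → M.Q (cokernel (c.d n (n - 1)))


/-- Cocycles in degree `n` of the complex `Hom(c, T)`. -/
noncomputable def cocycles (c : ChainComplex C ℤ) (T : C) (n : ℤ) :
    AddSubgroup (c.X n ⟶ T) :=
  (Preadditive.leftComp T (c.d (n + 1) n)).ker

/-- Coboundaries in degree `n` of the complex `Hom(c, T)`. -/
noncomputable def cobounds (c : ChainComplex C ℤ) (T : C) (n : ℤ) :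
    AddSubgroup (c.X n ⟶ T) :=
  (Preadditive.leftComp T (c.d n (n - 1)) : (c.X (n - 1) ⟶ T) →+ (c.X n ⟶ T)).range

/-- The cohomology group `Hⁿ[Hom(c, T)]`. -/
noncomputable def Hgrp (c : ChainComplex C ℤ) (T : C) (n : ℤ) :=
  cocycles c T n ⧸ (cobounds c T n).addSubgroupOf (cocycles c T n)

noncomputable instance (c : ChainComplex C ℤ) (T : C) (n : ℤ) : AddCommGroup (Hgrp c T n) := by
  unfold Hgrp; infer_instance

lemma comp_mem_cocycles {c : ChainComplex C ℤ} {T T' : C} {n : ℤ}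
    {f : c.X n ⟶ T} (hf : f ∈ cocycles c T n) (u : T ⟶ T') :
    f ≫ u ∈ cocycles c T' n := by
  simp only [cocycles, AddMonoidHom.mem_ker, Preadditive.leftComp] at hf ⊢
  simp only [AddMonoidHom.mk'_apply] at hf ⊢
  rw [← Category.assoc, hf, Limits.zero_comp]

lemma HoveyTriple.ext_Q (M : HoveyTriple.{w} C) (S : ShortComplex C) (hS : S.ShortExact)
    (h1 : M.Q S.X₁) (h3 : M.Q S.X₃) : M.Q S.X₂ := by
  refine M.orth₁_left fun Y hW hR => ?_
  have := M.orth₁ h1 hW hR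
  have := M.orth₁ h3 hW hR
  refine subsingleton_of_forall_eq 0 fun x => ?_
  obtain ⟨y, hy⟩ := Abelian.Ext.contravariant_sequence_exact₂ hS Y x (Subsingleton.elim _ _)
  rw [← hy, Subsingleton.elim y 0, Abelian.Ext.comp_zero]

open scoped ZeroObject in
lemma MResolution.Q_X {M : HoveyTriple.{w} C} {A : C} (hA : M.Q A) (WA : MResolution M A) (n : ℤ) :
    M.Q (WA.c.X n) := by
  rcases le_or_gt 0 n with hn | hn
  · exact (WA.comp_pos n hn).1
  have := WA.epi
  have := WA.mono
  rcases eq_or_ne n (-1) with rfl | hn'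
  · refine M.ext_Q (ShortComplex.mk WA.η (cokernel.π WA.η) (by simp)) ?_ hA WA.cok_eta
    exact { exact := ShortComplex.exact_cokernel _ }
  obtain ⟨m, rfl⟩ : ∃ m, n = m - 1 := ⟨n + 1, by ring⟩
  have hQ : M.Q (cokernel (WA.c.d (m + 1) m)) := by
    rcases eq_or_ne m (-1) with rfl | hm
    · have e : WA.c.d (-1 + 1) (-1) = WA.ε ≫ WA.η := WA.fac
      rw [e]
      refine M.ext_Q (ShortComplex.mk (0 : (0 : C) ⟶ _) (cokernelEpiComp WA.ε WA.η).hom (by simp))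
        ?_ ?_ WA.cok_eta
      · exact { exact := (ShortComplex.exact_iff_mono _ rfl).2 inferInstance
                mono_f := ⟨fun _ _ _ => Subsingleton.elim _ _⟩
                epi_g := inferInstanceAs (Epi (cokernelEpiComp WA.ε WA.η).hom) }
      · refine M.orth₁_left fun Y _ _ => ?_
        refine subsingleton_of_forall_eq 0 fun x => ?_
        rw [← Abelian.Ext.mk₀_id_comp x, (isZero_zero C).eq_of_src (𝟙 (0 : C)) 0]
        simp
    · have := WA.cok_d (m + 1) (by lia)
      simpa using (show (∀ k : ℤ, k = m → M.Q (cokernel (WA.c.d (m + 1) k))) from by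
        rintro k rfl
        have h := WA.cok_d (k + 1) (by lia)
        have e : k + 1 - 1 = k := by ring
        rwa [e] at h) m rfl
  have hex := WA.exact m
  refine M.ext_Q (ShortComplex.mk (cokernel.desc (WA.c.d (m + 1) m) (WA.c.d m (m - 1)) (by simp))
    (cokernel.π (WA.c.d m (m - 1))) (by ext; simp)) ?_ hQ (WA.cok_d m (by lia))
  have : Mono (cokernel.desc (WA.c.d (m + 1) m) (WA.c.d m (m - 1)) (by simp)) :=
    hex.mono_cokernelDesc
  refine { exact := ?_ }
  refine ShortComplex.exact_of_g_is_cokernel _ ?_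
  refine CokernelCofork.IsColimit.ofπ _ _ (fun k hk => cokernel.desc _ k ?_) ?_ ?_
  · rw [← cokernel.π_desc (WA.c.d (m + 1) m) (WA.c.d m (m - 1)) (by simp), Category.assoc, hk,
      comp_zero]
  · intro Z k hk
    simp
  · intro Z k hk b hb
    ext
    simpa using hb

lemma HoveyTriple.lift_exists (M : HoveyTriple.{w} C) {X F B B' : C} (hQ : M.Q X) (hW : M.W X)
    (hF : M.R F) {i : F ⟶ B} {p : B ⟶ B'} {wip : i ≫ p = 0}
    (hse : (ShortComplex.mk i p wip).ShortExact) (f : X ⟶ B') : ∃ g : X ⟶ B, g ≫ p = f := by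
  have := M.orth₂ hQ hW hF
  obtain ⟨y, hy⟩ := Abelian.Ext.covariant_sequence_exact₃ X hse (Abelian.Ext.mk₀ f)
    (zero_add 1) (Subsingleton.elim _ _)
  obtain ⟨g, rfl⟩ := (Abelian.Ext.mk₀_bijective X B).2 y
  refine ⟨g, (Abelian.Ext.mk₀_bijective X B').1 ?_⟩
  rw [← hy, Abelian.Ext.mk₀_comp_mk₀]

lemma mem_cocycles_iff {c : ChainComplex C ℤ} {T : C} {n : ℤ} (f : c.X n ⟶ T) :
    f ∈ cocycles c T n ↔ c.d (n + 1) n ≫ f = 0 := Iff.rfl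

lemma mem_cobounds_iff {c : ChainComplex C ℤ} {T : C} {n : ℤ} (f : c.X n ⟶ T) (m : ℤ)
    (hm : m + 1 = n) :
    f ∈ cobounds c T n ↔ ∃ g : c.X m ⟶ T, c.d n m ≫ g = f := by
  obtain rfl : m = n - 1 := by lia
  exact Iff.rfl

/-- The class of a cocycle. -/
noncomputable def mkH (c : ChainComplex C ℤ) (T : C) (n : ℤ) : cocycles c T n →+ Hgrp c T n where
  toFun := QuotientAddGroup.mk
  map_zero' := rfl
  map_add' _ _ := rfl

lemma mkH_surj (c : ChainComplex C ℤ) (T : C) (n : ℤ) (x : Hgrp c T n) :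
    ∃ f hf, mkH c T n ⟨f, hf⟩ = x := by
  obtain ⟨⟨f, hf⟩, h⟩ := QuotientAddGroup.mk_surjective x
  exact ⟨f, hf, h⟩

lemma mkH_eq_zero (c : ChainComplex C ℤ) (T : C) (n : ℤ) (x : cocycles c T n) :
    mkH c T n x = 0 ↔ x.1 ∈ cobounds c T n :=
  (QuotientAddGroup.eq_zero_iff x).trans AddSubgroup.mem_addSubgroupOf

lemma mkH_eq (c : ChainComplex C ℤ) (T : C) (n : ℤ) (x y : cocycles c T n) :
    mkH c T n x = mkH c T n y ↔ x.1 - y.1 ∈ cobounds c T n := by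
  rw [← sub_eq_zero, ← map_sub, mkH_eq_zero]
  rfl

/-- Descend a homomorphism to cohomology. -/
noncomputable def liftH {c : ChainComplex C ℤ} {T : C} {n : ℤ} {G : Type*} [AddCommGroup G]
    (φ : cocycles c T n →+ G) (h : ∀ x, x.1 ∈ cobounds c T n → φ x = 0) : Hgrp c T n →+ G where
  toFun := QuotientAddGroup.lift ((cobounds c T n).addSubgroupOf (cocycles c T n)) φ
    (fun x hx => h x (AddSubgroup.mem_addSubgroupOf.1 hx))
  map_zero' := map_zero (QuotientAddGroup.lift _ φ _)
  map_add' := map_add (QuotientAddGroup.lift _ φ _)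

lemma liftH_mk {c : ChainComplex C ℤ} {T : C} {n : ℤ} {G : Type*} [AddCommGroup G]
    (φ : cocycles c T n →+ G) (h : ∀ x, x.1 ∈ cobounds c T n → φ x = 0) (x : cocycles c T n) :
    liftH φ h (mkH c T n x) = φ x := rfl

/-- The map on cohomology induced by a morphism. -/
noncomputable def mapH (c : ChainComplex C ℤ) {T T' : C} (u : T ⟶ T') (n : ℤ) :
    Hgrp c T n →+ Hgrp c T' n :=
  liftH ((mkH c T' n).comp
    (AddMonoidHom.mk' (fun x => ⟨x.1 ≫ u, comp_mem_cocycles x.2 u⟩)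
      (fun x y => Subtype.ext (Preadditive.add_comp _ _ _ x.1 y.1 u)))) (by
    rintro x hx
    obtain ⟨g, hg⟩ := (mem_cobounds_iff _ (n - 1) (by ring)).1 hx
    refine (mkH_eq_zero _ _ _ _).2 ((mem_cobounds_iff _ (n - 1) (by ring)).2 ⟨g ≫ u, ?_⟩)
    simp [← hg])

lemma mapH_mk (c : ChainComplex C ℤ) {T T' : C} (u : T ⟶ T') (n : ℤ) (f : c.X n ⟶ T)
    (hf : f ∈ cocycles c T n) :
    mapH c u n (mkH c T n ⟨f, hf⟩) = mkH c T' n ⟨f ≫ u, comp_mem_cocycles hf u⟩ := rfl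

section
variable {c : ChainComplex C ℤ} {F B B' : C} {i : F ⟶ B} {p : B ⟶ B'} {wip : i ≫ p = 0}

lemma lift_i (hse : (ShortComplex.mk i p wip).ShortExact) {X : C} (g : X ⟶ B) (hg : g ≫ p = 0) :
    ∃ h : X ⟶ F, h ≫ i = g := by
  have : Mono i := hse.mono_f
  exact ⟨hse.exact.lift g hg, hse.exact.lift_f g hg⟩

lemma delta_data (hse : (ShortComplex.mk i p wip).ShortExact)
    (hl : ∀ (n : ℤ) (f : c.X n ⟶ B'), ∃ g : c.X n ⟶ B, g ≫ p = f) (n : ℤ)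
    (x : cocycles c B' n) : ∃ (h : cocycles c F (n + 1)) (g : c.X n ⟶ B), g ≫ p = x.1 ∧
      h.1 ≫ i = c.d (n + 1) n ≫ g := by
  have : Mono i := hse.mono_f
  obtain ⟨g, hg⟩ := hl n x.1
  obtain ⟨h, hh⟩ := lift_i hse (c.d (n + 1) n ≫ g) (by
    rw [Category.assoc, hg]; exact (mem_cocycles_iff _).1 x.2)
  refine ⟨⟨h, (mem_cocycles_iff _).2 ?_⟩, g, hg, hh⟩
  rw [← cancel_mono i]
  simp [hh]

lemma delta_uniq (hse : (ShortComplex.mk i p wip).ShortExact) (n : ℤ)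
    (h h' : cocycles c F (n + 1)) (g g' : c.X n ⟶ B) (hg : g ≫ p = g' ≫ p)
    (e : h.1 ≫ i = c.d (n + 1) n ≫ g) (e' : h'.1 ≫ i = c.d (n + 1) n ≫ g') :
    mkH c F (n + 1) h = mkH c F (n + 1) h' := by
  have : Mono i := hse.mono_f
  obtain ⟨k, hk⟩ := lift_i hse (g - g') (by simp [hg])
  refine (mkH_eq _ _ _ _ _).2 ((mem_cobounds_iff _ n rfl).2 ⟨k, ?_⟩)
  rw [← cancel_mono i]
  simp [e, e', hk, sub_eq_add_neg]

/-- The connecting homomorphism. -/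
noncomputable def deltaH (hse : (ShortComplex.mk i p wip).ShortExact)
    (hl : ∀ (n : ℤ) (f : c.X n ⟶ B'), ∃ g : c.X n ⟶ B, g ≫ p = f) (n : ℤ) :
    Hgrp c B' n →+ Hgrp c F (n + 1) :=
  liftH (AddMonoidHom.mk' (fun x => mkH c F (n + 1) (delta_data hse hl n x).choose) (by
      intro x y
      obtain ⟨g, hg, e⟩ := (delta_data hse hl n x).choose_spec
      obtain ⟨g', hg', e'⟩ := (delta_data hse hl n y).choose_spec
      obtain ⟨g'', hg'', e''⟩ := (delta_data hse hl n (x + y)).choose_spec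
      rw [← map_add]
      refine delta_uniq hse n _ _ g'' (g + g') (by simp [hg, hg', hg'']) e'' ?_
      simp [e, e'])) (by
    intro x hx
    obtain ⟨g, hg, e⟩ := (delta_data hse hl n x).choose_spec
    obtain ⟨k, hk⟩ := (mem_cobounds_iff _ (n - 1) (by ring)).1 hx
    obtain ⟨k', rfl⟩ := hl _ k
    rw [← map_zero (mkH c F (n + 1))]
    refine delta_uniq hse n _ _ g (c.d n (n - 1) ≫ k') (by simp [hg, hk]) e ?_
    simp)

lemma deltaH_mk (hse : (ShortComplex.mk i p wip).ShortExact)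
    (hl : ∀ (n : ℤ) (f : c.X n ⟶ B'), ∃ g : c.X n ⟶ B, g ≫ p = f) (n : ℤ)
    (x : cocycles c B' n) (h : cocycles c F (n + 1)) (g : c.X n ⟶ B) (hg : g ≫ p = x.1)
    (e : h.1 ≫ i = c.d (n + 1) n ≫ g) :
    deltaH hse hl n (mkH c B' n x) = mkH c F (n + 1) h := by
  obtain ⟨g', hg', e'⟩ := (delta_data hse hl n x).choose_spec
  exact delta_uniq hse n _ _ g' g (by rw [hg, hg']) e' e

end

/-- for `A` cofibrant, every short exact sequence `0 → F → B → B' → 0` with `F`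
fibrant induces a long exact cohomology sequence
`··· → ℓExtⁿ⁻¹(A,B') → ℓExtⁿ(A,F) → ℓExtⁿ(A,B) → ℓExtⁿ(A,B') → ℓExtⁿ⁺¹(A,F) → ···`,
where `ℓExtⁿ(A,−) = Hⁿ[Hom(W_A, −)]` for an `𝔐`-resolution `W_A` of `A`, and where the maps
between the `ℓExt` groups of `F`, `B`, `B'` are induced by the given short exact sequence. -/
theorem statement10 (M : HoveyTriple.{w} C) (A : C) (hA : M.Q A) (WA : MResolution M A)
    (F B B' : C) (hF : M.R F) (i : F ⟶ B) (p : B ⟶ B') (wip : i ≫ p = 0)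
    (hse : (ShortComplex.mk i p wip).ShortExact) :
    ∃ (α : ∀ n : ℤ, Hgrp WA.c F n →+ Hgrp WA.c B n)
      (β : ∀ n : ℤ, Hgrp WA.c B n →+ Hgrp WA.c B' n)
      (δ : ∀ n : ℤ, Hgrp WA.c B' n →+ Hgrp WA.c F (n + 1)),
      (∀ (n : ℤ) (f : WA.c.X n ⟶ F) (hf : f ∈ cocycles WA.c F n),
          α n (QuotientAddGroup.mk ⟨f, hf⟩) =
            QuotientAddGroup.mk ⟨f ≫ i, comp_mem_cocycles hf i⟩) ∧
      (∀ (n : ℤ) (f : WA.c.X n ⟶ B) (hf : f ∈ cocycles WA.c B n),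
          β n (QuotientAddGroup.mk ⟨f, hf⟩) =
            QuotientAddGroup.mk ⟨f ≫ p, comp_mem_cocycles hf p⟩) ∧
      (∀ n : ℤ, Function.Exact (α n) (β n)) ∧
      (∀ n : ℤ, Function.Exact (β n) (δ n)) ∧
      (∀ n : ℤ, Function.Exact (δ n) (α (n + 1))) := by
  have hl : ∀ (n : ℤ) (f : WA.c.X n ⟶ B'), ∃ g : WA.c.X n ⟶ B, g ≫ p = f := fun n f =>
    M.lift_exists (WA.Q_X hA n)
      ((le_or_gt 0 n).elim (fun h => (WA.comp_pos n h).2) (fun h => (WA.comp_neg n h).1)) hF hse f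
  have : Mono i := hse.mono_f
  refine ⟨mapH WA.c i, mapH WA.c p, deltaH hse hl, fun n f hf => rfl, fun n f hf => rfl,
    fun n => ?_, fun n => ?_, fun n => ?_⟩
  · intro y
    constructor
    · intro hy
      obtain ⟨f, hf, rfl⟩ := mkH_surj _ _ _ y
      rw [mapH_mk, mkH_eq_zero, mem_cobounds_iff _ (n - 1) (by ring)] at hy
      obtain ⟨k, hk⟩ := hy
      obtain ⟨k', rfl⟩ := hl _ k
      obtain ⟨h, hh⟩ := lift_i hse (f - WA.c.d n (n - 1) ≫ k') (by simpa [sub_eq_zero] using hk.symm)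
      refine ⟨mkH _ _ _ ⟨h, (mem_cocycles_iff _).2 ?_⟩, ?_⟩
      · rw [← cancel_mono i]
        simp [hh, (mem_cocycles_iff _).1 hf]
      · rw [mapH_mk, mkH_eq, mem_cobounds_iff _ (n - 1) (by ring)]
        exact ⟨-k', by simp [hh]⟩
    · rintro ⟨x, rfl⟩
      obtain ⟨f, hf, rfl⟩ := mkH_surj _ _ _ x
      rw [mapH_mk, mapH_mk, mkH_eq_zero, mem_cobounds_iff _ (n - 1) (by ring)]
      exact ⟨0, by simp [wip]⟩
  · intro y
    constructor
    · intro hy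
      obtain ⟨f, hf, rfl⟩ := mkH_surj _ _ _ y
      obtain ⟨h, g, hg, e⟩ := delta_data hse hl n ⟨f, hf⟩
      rw [deltaH_mk hse hl n _ h g hg e, mkH_eq_zero, mem_cobounds_iff _ n rfl] at hy
      obtain ⟨k, hk⟩ := hy
      refine ⟨mkH _ _ _ ⟨g - k ≫ i, (mem_cocycles_iff _).2 ?_⟩, ?_⟩
      · rw [Preadditive.comp_sub, ← e, ← hk, Category.assoc, sub_self]
      · rw [mapH_mk]
        congr 2
        simpa [wip] using hg
    · rintro ⟨x, rfl⟩
      obtain ⟨f, hf, rfl⟩ := mkH_surj _ _ _ x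
      rw [mapH_mk, deltaH_mk hse hl n _ 0 f rfl, map_zero]
      simp [(mem_cocycles_iff _).1 hf]
  · intro y
    constructor
    · intro hy
      obtain ⟨f, hf, rfl⟩ := mkH_surj _ _ _ y
      rw [mapH_mk, mkH_eq_zero, mem_cobounds_iff _ n rfl] at hy
      obtain ⟨g, hg⟩ := hy
      refine ⟨mkH _ _ _ ⟨g ≫ p, (mem_cocycles_iff _).2 ?_⟩, ?_⟩
      · rw [← Category.assoc, hg, Category.assoc, wip, comp_zero]
      · exact deltaH_mk hse hl n _ _ g rfl hg.symm
    · rintro ⟨x, rfl⟩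
      obtain ⟨f, hf, rfl⟩ := mkH_surj _ _ _ x
      obtain ⟨h, g, hg, e⟩ := delta_data hse hl n ⟨f, hf⟩
      rw [deltaH_mk hse hl n _ h g hg e, mapH_mk, mkH_eq_zero, mem_cobounds_iff _ n rfl]
      exact ⟨g, e.symm⟩
end

section
/- Let M = (Q, W, R) be a hereditary abelian model structure on an abelian category A. If A is cofibrant and B is fibrant, then for every integer n ≥ 0 there is an isomorphism Hⁿ[Hom_A(W_A, B)] ≅ Hom_A(ΩⁿA, B)/∼ω, where W_A is an M-resolution of A, ΩⁿA is the n-th cycle object Z_{n-1}(W_A) of the resolution, and ∼ω identifies maps that factor through an object of the core ω = Q ∩ W ∩ R. -/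
open CategoryTheory CategoryTheory.Limits

universe w v u

variable {C : Type u} [Category.{v} C] [Abelian C]

variable [HasExt.{w} C]

/-- The subgroup (generated by) the morphisms factoring through an object of the core
`ω = 𝒬 ∩ 𝒲 ∩ ℛ`. -/
def omegaFactorSub (M : HoveyTriple.{w} C) (X Y : C) : AddSubgroup (X ⟶ Y) :=
  AddSubgroup.closure
    {f : X ⟶ Y | ∃ ω : C, (M.Q ω ∧ M.W ω ∧ M.R ω) ∧ ∃ (a : X ⟶ ω) (b : ω ⟶ Y), f = a ≫ b}

section Helpers

open Abelian

/-- Maps lift along an epimorphism whose kernel is `Ext¹`-orthogonal. -/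
lemma aux_lift {S : ShortComplex C} (hS : S.ShortExact) {X : C}
    (h : Subsingleton (Ext X S.X₁ 1)) (f : X ⟶ S.X₃) : ∃ g : X ⟶ S.X₂, g ≫ S.g = f := by
  obtain ⟨x, hx⟩ := Ext.covariant_sequence_exact₃ X hS (Ext.mk₀ f) (zero_add 1)
    (Subsingleton.elim _ _)
  obtain ⟨g, rfl⟩ := (Ext.mk₀_bijective _ _).2 x
  rw [Ext.mk₀_comp_mk₀] at hx
  exact ⟨g, (Ext.mk₀_bijective _ _).1 hx⟩

/-- Maps extend along a monomorphism whose cokernel is `Ext¹`-orthogonal. -/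
lemma aux_extend {S : ShortComplex C} (hS : S.ShortExact) {Y : C}
    (h : Subsingleton (Ext S.X₃ Y 1)) (f : S.X₁ ⟶ Y) : ∃ g : S.X₂ ⟶ Y, S.f ≫ g = f := by
  obtain ⟨x, hx⟩ := Ext.contravariant_sequence_exact₁ hS Y (Ext.mk₀ f) (add_zero 1)
    (Subsingleton.elim _ _)
  obtain ⟨g, rfl⟩ := (Ext.mk₀_bijective _ _).2 x
  rw [Ext.mk₀_comp_mk₀] at hx
  exact ⟨g, (Ext.mk₀_bijective _ _).1 hx⟩

/-- Fibrant objects are closed under extensions. -/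
lemma R_ext (M : HoveyTriple.{w} C) {S : ShortComplex C} (hS : S.ShortExact)
    (h₁ : M.R S.X₁) (h₃ : M.R S.X₃) : M.R S.X₂ := by
  apply M.orth₂_right
  intro X hQ hW
  have i₁ := M.orth₂ hQ hW h₁
  have i₃ := M.orth₂ hQ hW h₃
  refine subsingleton_of_forall_eq 0 fun x => ?_
  obtain ⟨y, rfl⟩ := Ext.covariant_sequence_exact₂ X hS x (Subsingleton.elim _ _)
  rw [Subsingleton.elim y 0, Ext.zero_comp]

/-- Cofibrant objects are closed under kernels of epimorphisms. -/
lemma Q_ker (M : HoveyTriple.{w} C) {S : ShortComplex C} (hS : S.ShortExact)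
    (h₂ : M.Q S.X₂) (h₃ : M.Q S.X₃) : M.Q S.X₁ := by
  apply M.orth₁_left
  intro Y hW hR
  have i₂ := M.orth₁ h₂ hW hR
  have i₃ := M.hereditary₁ 2 (by norm_num) h₃ hW hR
  refine subsingleton_of_forall_eq 0 fun x => ?_
  obtain ⟨y, rfl⟩ := Ext.contravariant_sequence_exact₁ hS Y x (n₁ := 2) rfl
    (Subsingleton.elim _ _)
  rw [Subsingleton.elim y 0, Ext.comp_zero]

lemma Q_iso (M : HoveyTriple.{w} C) {X Y : C} (e : X ≅ Y) (h : M.Q X) : M.Q Y := by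
  apply M.orth₁_left
  intro T hW hR
  have i := M.orth₁ h hW hR
  refine subsingleton_of_forall_eq 0 fun x => ?_
  have : (Ext.mk₀ e.inv).comp ((Ext.mk₀ e.hom).comp x (zero_add 1)) (zero_add 1) = x := by
    rw [Ext.mk₀_comp_mk₀_assoc, e.inv_hom_id, Ext.mk₀_id_comp]
  rw [← this, Subsingleton.elim ((Ext.mk₀ e.hom).comp x (zero_add 1)) 0, Ext.comp_zero]

/-- A map from a cofibrant object to a fibrant object through a trivial object factors
through the core. -/
lemma factor_omega (M : HoveyTriple.{w} C) {Z V B : C} (hZ : M.Q Z) (hV : M.W V) (hB : M.R B)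
    (i : Z ⟶ V) (g : V ⟶ B) :
    ∃ ω : C, (M.Q ω ∧ M.W ω ∧ M.R ω) ∧ ∃ (a : Z ⟶ ω) (b : ω ⟶ B), i ≫ g = a ≫ b := by
  obtain ⟨E, K, j, p, w, hRE, hQK, hWK, hS⟩ := M.complete₂_inj V
  have hWE := (M.thick_two_of_three j p w hS).2.1 hV hWK
  obtain ⟨g', hg'⟩ := aux_extend hS (M.orth₂ hQK hWK hB) g
  obtain ⟨K', E', j', p', w', hQE', hWK', hRK', hS'⟩ := M.complete₁_proj E
  have hWE' := (M.thick_two_of_three j' p' w' hS').2.1 hWK' hWE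
  have hRE' : M.R E' := R_ext M hS' hRK' hRE
  obtain ⟨a, ha⟩ := aux_lift hS' (M.orth₁ hZ hWK' hRK') (i ≫ j)
  refine ⟨E', ⟨hQE', hWE', hRE'⟩, a, p' ≫ g', ?_⟩
  dsimp at ha hg'
  rw [← Category.assoc, ha, Category.assoc, hg']

variable {X₃ X₂ X₁ X₀ : C}

lemma epi_klift {f : X₂ ⟶ X₁} {g : X₁ ⟶ X₀} {w : f ≫ g = 0} (h : (ShortComplex.mk f g w).Exact) :
    Epi (kernel.lift g f w) := h.epi_kernelLift

/-- The short exact sequence `ker f → X₂ → ker g` of an exact complex. -/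
lemma ses_ker {f : X₂ ⟶ X₁} {g : X₁ ⟶ X₀} {w : f ≫ g = 0} (h : (ShortComplex.mk f g w).Exact)
    (w' : kernel.ι f ≫ kernel.lift g f w = 0) :
    (ShortComplex.mk (kernel.ι f) (kernel.lift g f w) w').ShortExact := by
  have := epi_klift h
  have h1 : (ShortComplex.mk (kernel.ι f) f (kernel.condition f)).Exact :=
    ShortComplex.exact_of_f_is_kernel _ (kernelIsKernel f)
  let φ : ShortComplex.mk (kernel.ι f) (kernel.lift g f w) w' ⟶
      ShortComplex.mk (kernel.ι f) f (kernel.condition f) :=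
    { τ₁ := 𝟙 _, τ₂ := 𝟙 _, τ₃ := kernel.ι g }
  have : Epi φ.τ₁ := by dsimp [φ]; infer_instance
  have : IsIso φ.τ₂ := by dsimp [φ]; infer_instance
  have : Mono φ.τ₃ := by dsimp [φ]; infer_instance
  have h2 := (ShortComplex.exact_iff_of_epi_of_isIso_of_mono φ).2 h1
  exact { exact := h2, mono_f := by dsimp; infer_instance, epi_g := by dsimp; infer_instance }

lemma klift_zero {f : X₂ ⟶ X₁} {g : X₁ ⟶ X₀} (w : f ≫ g = 0) {h : X₃ ⟶ X₂} (w' : h ≫ f = 0) :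
    h ≫ kernel.lift g f w = 0 := by
  rw [← cancel_mono (kernel.ι g)]; simp [w']

lemma exact_klift {h : X₃ ⟶ X₂} {f : X₂ ⟶ X₁} {g : X₁ ⟶ X₀} {w : f ≫ g = 0} {w' : h ≫ f = 0}
    (hex : (ShortComplex.mk h f w').Exact) :
    (ShortComplex.mk h (kernel.lift g f w) (klift_zero w w')).Exact := by
  let φ : ShortComplex.mk h (kernel.lift g f w) (klift_zero w w') ⟶ ShortComplex.mk h f w' :=
    { τ₁ := 𝟙 _, τ₂ := 𝟙 _, τ₃ := kernel.ι g }
  have : Epi φ.τ₁ := by dsimp [φ]; infer_instance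
  have : IsIso φ.τ₂ := by dsimp [φ]; infer_instance
  have : Mono φ.τ₃ := by dsimp [φ]; infer_instance
  exact (ShortComplex.exact_iff_of_epi_of_isIso_of_mono φ).2 hex

lemma res_exact {M : HoveyTriple.{w} C} {A : C} (WA : MResolution M A) (i j k : ℤ)
    (hi : i = j + 1) (hk : k = j - 1) :
    (ShortComplex.mk (WA.c.d i j) (WA.c.d j k) (WA.c.d_comp_d _ _ _)).Exact := by
  subst hi hk
  exact WA.exact j

lemma Q_Z1 {M : HoveyTriple.{w} C} {A : C} (hA : M.Q A) (WA : MResolution M A) :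
    M.Q (kernel (WA.c.d (-1) (-2))) := by
  have := WA.epi
  have := WA.mono
  have w : WA.η ≫ WA.c.d (-1) (-2) = 0 := by
    rw [← cancel_epi WA.ε, ← Category.assoc, ← WA.fac]; simp
  have hp := epi_klift (res_exact WA 0 (-1) (-2) (by norm_num) (by norm_num))
  have e : WA.ε ≫ kernel.lift _ WA.η w =
      kernel.lift _ (WA.c.d 0 (-1)) (WA.c.d_comp_d _ _ _) := by
    rw [← cancel_mono (kernel.ι _)]; simp [WA.fac]
  have : Epi (kernel.lift _ WA.η w) := by
    rw [← e] at hp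
    exact epi_of_epi WA.ε _
  have : Mono (kernel.lift _ WA.η w) := by
    have : Mono (kernel.lift _ WA.η w ≫ kernel.ι _) := by simpa
    exact mono_of_mono _ (kernel.ι _)
  have := isIso_of_mono_of_epi (kernel.lift _ WA.η w)
  exact Q_iso M (asIso (kernel.lift _ WA.η w)) hA

lemma Q_Z2 {M : HoveyTriple.{w} C} {A : C} (WA : MResolution M A) :
    M.Q (kernel (WA.c.d (-2) (-3))) := by
  have := WA.epi
  have := WA.mono
  have w : WA.η ≫ WA.c.d (-1) (-2) = 0 := by
    rw [← cancel_epi WA.ε, ← Category.assoc, ← WA.fac]; simp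
  have h1 := res_exact WA 0 (-1) (-2) (by norm_num) (by norm_num)
  have h2 := res_exact WA (-1) (-2) (-3) (by norm_num) (by norm_num)
  have hex : (ShortComplex.mk WA.η (WA.c.d (-1) (-2)) w).Exact := by
    let φ : ShortComplex.mk (WA.c.d 0 (-1)) (WA.c.d (-1) (-2)) (WA.c.d_comp_d _ _ _) ⟶
        ShortComplex.mk WA.η (WA.c.d (-1) (-2)) w :=
      { τ₁ := WA.ε, τ₂ := 𝟙 _, τ₃ := 𝟙 _, comm₁₂ := by simp [WA.fac] }
    have : Epi φ.τ₁ := by dsimp [φ]; infer_instance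
    have : IsIso φ.τ₂ := by dsimp [φ]; infer_instance
    have : Mono φ.τ₃ := by dsimp [φ]; infer_instance
    exact (ShortComplex.exact_iff_of_epi_of_isIso_of_mono φ).1 h1
  have h3 := exact_klift (w := WA.c.d_comp_d (-1) (-2) (-3)) hex
  have := epi_klift h2
  exact Q_iso M ((cokernelIsCokernel WA.η).coconePointUniqueUpToIso h3.gIsCokernel) WA.cok_eta

/-- Cycles of an `𝔐`-resolution are cofibrant. -/
lemma Q_Z {M : HoveyTriple.{w} C} {A : C} (hA : M.Q A) (WA : MResolution M A) (n : ℕ) :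
    ∀ j k : ℤ, j = (n : ℤ) - 1 → k = (n : ℤ) - 2 → M.Q (kernel (WA.c.d j k)) := by
  induction n with
  | zero =>
    rintro j k rfl rfl
    exact Q_Z1 hA WA
  | succ n ih =>
    intro j k hj hk
    push_cast at hj hk
    have hex := res_exact WA j k ((n : ℤ) - 2) (by lia) (by lia)
    exact Q_ker M (ses_ker hex (klift_zero _ (kernel.condition _)))
      (WA.comp_pos j (by lia)).1 (ih k _ (by lia) rfl)

lemma W_X {M : HoveyTriple.{w} C} {A : C} (WA : MResolution M A) (n : ℤ) : M.W (WA.c.X n) := by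
  rcases le_or_gt 0 n with h | h
  · exact (WA.comp_pos n h).2
  · exact (WA.comp_neg n h).1

/-- Extendable maps on cycles are the maps in the subgroup of the core. -/
lemma mem_omega_iff {M : HoveyTriple.{w} C} {A B : C} (hA : M.Q A) (hB : M.R B)
    (WA : MResolution M A) (n : ℕ) (f : kernel (WA.c.d ((n : ℤ) - 1) ((n : ℤ) - 2)) ⟶ B) :
    f ∈ omegaFactorSub M (kernel (WA.c.d ((n : ℤ) - 1) ((n : ℤ) - 2))) B ↔
      ∃ g, kernel.ι (WA.c.d ((n : ℤ) - 1) ((n : ℤ) - 2)) ≫ g = f := by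
  constructor
  · intro hf
    have hQ : M.Q (kernel (WA.c.d ((n : ℤ) - 2) ((n : ℤ) - 3))) := by
      rcases n with _ | n
      · exact Q_Z2 WA
      · exact Q_Z hA WA n _ _ (by push_cast; ring) (by push_cast; ring)
    have hex := res_exact WA ((n : ℤ) - 1) ((n : ℤ) - 2) ((n : ℤ) - 3) (by ring) (by ring)
    have hS := ses_ker hex (klift_zero _ (kernel.condition _))
    induction hf using AddSubgroup.closure_induction with
    | mem x hx =>
      obtain ⟨ω, ⟨-, hW, hR⟩, a, b, rfl⟩ := hx
      obtain ⟨a', ha'⟩ := aux_extend hS (M.orth₁ hQ hW hR) a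
      refine ⟨a' ≫ b, ?_⟩
      rw [← ha', Category.assoc]
    | zero => exact ⟨0, by simp⟩
    | add x y _ _ hx hy =>
      obtain ⟨g, rfl⟩ := hx
      obtain ⟨g', rfl⟩ := hy
      exact ⟨g + g', by simp⟩
    | neg x _ hx =>
      obtain ⟨g, rfl⟩ := hx
      exact ⟨-g, by simp⟩
  · rintro ⟨g, rfl⟩
    exact AddSubgroup.subset_closure
      (factor_omega M (Q_Z hA WA n _ _ rfl rfl) (W_X WA _) hB _ g)

end Helpers

/-- for `A` cofibrant and `B` fibrant, `Hⁿ[Hom(W_A, B)] ≅ Hom(ΩⁿA, B)/∼ω`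
for every `n ≥ 0`, where `ΩⁿA = Z_{n-1}(W_A)` is the `n`-th cycle object of an
`𝔐`-resolution `W_A` of `A` and `∼ω` identifies maps factoring through the core. -/
theorem statement12 (M : HoveyTriple.{w} C) (A B : C) (hA : M.Q A) (hB : M.R B)
    (WA : MResolution M A) (n : ℕ) :
    Nonempty (Hgrp WA.c B (n : ℤ) ≃+
      ((kernel (WA.c.d ((n : ℤ) - 1) ((n : ℤ) - 2)) ⟶ B) ⧸
        omegaFactorSub M (kernel (WA.c.d ((n : ℤ) - 1) ((n : ℤ) - 2))) B)) := by
  have hex1 := res_exact WA (n : ℤ) ((n : ℤ) - 1) ((n : ℤ) - 2) (by ring) (by ring)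
  have hex2 := res_exact WA ((n : ℤ) + 1) (n : ℤ) ((n : ℤ) - 1) rfl rfl
  have w := WA.c.d_comp_d (n : ℤ) ((n : ℤ) - 1) ((n : ℤ) - 2)
  have hp := epi_klift hex1
  have hz := exact_klift (w := w) hex2
  let p := kernel.lift _ _ w
  have hpι : p ≫ kernel.ι _ = WA.c.d (n : ℤ) ((n : ℤ) - 1) := kernel.lift_ι _ _ _
  let ψ₀ : (kernel (WA.c.d ((n : ℤ) - 1) ((n : ℤ) - 2)) ⟶ B) →+ cocycles WA.c B (n : ℤ) :=
    (Preadditive.leftComp B p).codRestrict _ (fun f => by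
      change WA.c.d ((n : ℤ) + 1) n ≫ p ≫ f = 0
      rw [← Category.assoc, klift_zero w (WA.c.d_comp_d _ _ _), zero_comp])
  let ψ : (kernel (WA.c.d ((n : ℤ) - 1) ((n : ℤ) - 2)) ⟶ B) →+ Hgrp WA.c B (n : ℤ) :=
    (QuotientAddGroup.mk' ((cobounds WA.c B n).addSubgroupOf (cocycles WA.c B n))).comp ψ₀
  have hψ : Function.Surjective ψ := by
    refine (QuotientAddGroup.mk'_surjective _).comp ?_
    rintro ⟨g, hg⟩
    have hg' : WA.c.d ((n : ℤ) + 1) n ≫ g = 0 := hg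
    exact ⟨hz.desc g hg', Subtype.ext (hz.g_desc g hg')⟩
  have hker : ψ.ker = omegaFactorSub M (kernel (WA.c.d ((n : ℤ) - 1) ((n : ℤ) - 2))) B := by
    ext f
    rw [mem_omega_iff hA hB WA n f]
    have h1 : f ∈ ψ.ker ↔ p ≫ f ∈ cobounds WA.c B n := by
      refine (QuotientAddGroup.eq_zero_iff (ψ₀ f)).trans ?_
      exact AddSubgroup.mem_addSubgroupOf
    rw [h1]
    constructor
    · rintro ⟨g, hg⟩
      have hg' : WA.c.d (n : ℤ) ((n : ℤ) - 1) ≫ g = p ≫ f := hg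
      refine ⟨g, ?_⟩
      rw [← cancel_epi p, ← hg', ← hpι, Category.assoc]
    · rintro ⟨g, rfl⟩
      refine ⟨g, ?_⟩
      change WA.c.d (n : ℤ) ((n : ℤ) - 1) ≫ g = _
      rw [← hpι, Category.assoc]
  exact ⟨((QuotientAddGroup.quotientAddEquivOfEq hker).symm.trans
    (QuotientAddGroup.quotientKerEquivOfSurjective ψ hψ)).symm⟩
end
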